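/- arXiv:2512.01604 — 8 statements merged into one kernel-verified Lean document; each statement's English description precedes it below -/
import Mathlib

section
/- Let p be a prime, let d ≥ 2 and t ≥ 1 be integers with p > d·t, and set N = d·t − d + 2. Then there exists a vector a = (a_1, …, a_N) ∈ 𝔽_p^N such that Σ_{j=1}^{N} a_j · j^{d−1} = 1 and, for every integer v with d ≤ v ≤ d·t, Σ_{j=1}^{N} a_j · j^{v} = 0. -/
/-- For a prime `p` and integers `d ≥ 2`, `t ≥ 1` with `p > d·t`, with
`N = d·t − d + 2`, there is a vector `a ∈ 𝔽_p^N` with `Σ_{j=1}^N a_j · j^(d−1) = 1` and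
`Σ_{j=1}^N a_j · j^v = 0` for every `v` with `d ≤ v ≤ d·t`. -/
theorem stmt_1 (p d t : ℕ) [Fact p.Prime] (hd : 2 ≤ d) (ht : 1 ≤ t) (hpt : d * t < p) :
    ∃ a : Fin (d * t - d + 2) → ZMod p,
      (∑ j, a j * ((j.1 + 1 : ℕ) : ZMod p) ^ (d - 1)) = 1 ∧
      ∀ v : ℕ, d ≤ v → v ≤ d * t →
        (∑ j, a j * ((j.1 + 1 : ℕ) : ZMod p) ^ v) = 0 := by
  have hdt : d ≤ d * t := Nat.le_mul_of_pos_right d ht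
  generalize d * t = m at *
  set x : Fin (m - d + 2) → ZMod p := fun j => ((j.1 + 1 : ℕ) : ZMod p) with hx
  have hval : ∀ j, (x j).val = j.1 + 1 := fun j =>
    ZMod.val_cast_of_lt (by have := j.2; omega)
  have hinj : Function.Injective x := by
    intro i j h
    have := congrArg ZMod.val h
    rw [hval, hval] at this
    exact Fin.ext (by omega)
  have hne : ∀ j, x j ≠ 0 := by
    intro j h
    have := hval j
    rw [h, ZMod.val_zero] at this
    omega
  have hdet : IsUnit (Matrix.vandermonde x).det :=
    (Matrix.det_vandermonde_ne_zero_iff.mpr hinj).isUnit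
  obtain ⟨b, hb⟩ : ∃ b, Matrix.vecMul b (Matrix.vandermonde x) = Pi.single 0 1 := by
    refine ⟨Matrix.vecMul (Pi.single 0 1) (Matrix.vandermonde x)⁻¹, ?_⟩
    rw [Matrix.vecMul_vecMul, Matrix.nonsing_inv_mul _ hdet, Matrix.vecMul_one]
  have key : ∀ k : Fin (m - d + 2), ∑ j, (b j * (x j ^ (d - 1))⁻¹) * x j ^ (d - 1 + k.1)
      = (Pi.single 0 1 : Fin (m - d + 2) → ZMod p) k := by
    intro k
    rw [← hb]
    simp only [Matrix.vecMul, dotProduct, Matrix.vandermonde_apply]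
    refine Finset.sum_congr rfl fun j _ => ?_
    have := pow_ne_zero (d - 1) (hne j)
    rw [pow_add, mul_assoc, inv_mul_cancel_left₀ this]
  refine ⟨fun j => b j * (x j ^ (d - 1))⁻¹, ?_, ?_⟩
  · have h := key 0
    rw [Pi.single_eq_same] at h
    exact h
  · intro v h1 h2
    have h := key ⟨v - (d - 1), by omega⟩
    rw [Pi.single_eq_of_ne (by intro h; have := congrArg Fin.val h; simp at this; omega)] at h
    simpa only [show d - 1 + (v - (d - 1)) = v by omega] using h
end

section
/- Let p be a prime, let d ≥ 2 and t ≥ 1 be integers, set N = d·t − d + 2, and let a = (a_1, …, a_N) ∈ 𝔽_p^N satisfy Σ_{j=1}^{N} a_j · j^{v} = 0 for every integer v with d ≤ v ≤ d·t. Then for every family of field elements r_{u,i} ∈ 𝔽_p (u ∈ {1,…,t}, i ∈ {1,…,d}), Σ_{j=1}^{N} a_j · Π_{i=1}^{d} ( Σ_{u=1}^{t} j^u · r_{u,i} ) = 0. -/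
/-- If `a ∈ 𝔽_p^N` (`N = d·t − d + 2`) satisfies `Σ_{j=1}^N a_j · j^v = 0`
for all `d ≤ v ≤ d·t`, then for any randomness `r_{u,i}` (`u ∈ {1,…,t}`, `i ∈ {1,…,d}`),
`Σ_{j=1}^N a_j · Π_{i=1}^d (Σ_{u=1}^t j^u · r_{u,i}) = 0`. -/
theorem stmt_2 (p d t : ℕ) [Fact p.Prime] (hd : 2 ≤ d) (ht : 1 ≤ t)
    (a : Fin (d * t - d + 2) → ZMod p)
    (ha : ∀ v : ℕ, d ≤ v → v ≤ d * t →
      (∑ j, a j * ((j.1 + 1 : ℕ) : ZMod p) ^ v) = 0)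
    (r : Fin t → Fin d → ZMod p) :
    ∑ j, a j * ∏ i : Fin d,
      (∑ u : Fin t, ((j.1 + 1 : ℕ) : ZMod p) ^ (u.1 + 1) * r u i) = 0 := by
  simp only [Finset.prod_univ_sum, Finset.mul_sum]
  rw [Finset.sum_comm]
  refine Finset.sum_eq_zero fun f _ => ?_
  have h1 : d ≤ ∑ i : Fin d, ((f i).1 + 1) := by
    have h := Finset.card_nsmul_le_sum (Finset.univ : Finset (Fin d))
      (fun i => (f i).1 + 1) 1 (fun i _ => by omega)
    simpa using h
  have h2 : ∑ i : Fin d, ((f i).1 + 1) ≤ d * t := by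
    have h := Finset.sum_le_card_nsmul (Finset.univ : Finset (Fin d))
      (fun i => (f i).1 + 1) t (fun i _ => (f i).2)
    simpa only [Finset.card_univ, Fintype.card_fin, smul_eq_mul] using h
  have h := ha _ h1 h2
  simp only [Finset.prod_mul_distrib, Finset.prod_pow_eq_pow_sum, ← mul_assoc]
  rw [← Finset.sum_mul, h, zero_mul]
end

section
/- Let p be a prime, let d ≥ 2 and t ≥ 1 be integers, set N = d·t − d + 2, and let a = (a_1, …, a_N) ∈ 𝔽_p^N satisfy Σ_{j=1}^{N} a_j · j^{d−1} = 1 and Σ_{j=1}^{N} a_j · j^{v} = 0 for every integer v with d ≤ v ≤ d·t. Then for every family of field elements r_{u,i} ∈ 𝔽_p (u ∈ {1,…,t}, i ∈ {1,…,d}), Σ_{j=1}^{N} a_j · ( Π_{i=1}^{d−1} ( Σ_{u=1}^{t} j^u · r_{u,i} ) ) · ( 1 + Σ_{u=1}^{t} j^u · r_{u,d} ) = Π_{i=1}^{d−1} r_{1,i}. -/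
open Polynomial in
theorem aux_share {F ι : Type*} [Field F] [Fintype ι] (n t : ℕ) (ht : 1 ≤ t)
    (a x : ι → F) (h1 : ∑ j, a j * x j ^ n = 1)
    (h0 : ∀ v : ℕ, n + 1 ≤ v → v ≤ (n + 1) * t → ∑ j, a j * x j ^ v = 0)
    (R : Fin t → Fin n → F) (l : Fin t → F) :
    ∑ j, a j * ((∏ i : Fin n, ∑ u : Fin t, x j ^ (u.1 + 1) * R u i) *
      (1 + ∑ u : Fin t, x j ^ (u.1 + 1) * l u)) = ∏ i : Fin n, R ⟨0, ht⟩ i := by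
  obtain ⟨s, rfl⟩ : ∃ s, t = s + 1 := ⟨t - 1, by omega⟩
  let Q : F[X] := (∏ i : Fin n, ∑ u : Fin (s + 1), C (R u i) * X ^ u.1) *
    (1 + ∑ u : Fin (s + 1), C (l u) * X ^ (u.1 + 1))
  have hdeg : Q.natDegree ≤ n * s + (s + 1) := by
    refine natDegree_mul_le_of_le ?_ ?_
    · refine (natDegree_prod_le _ _).trans ?_
      refine (Finset.sum_le_card_nsmul _ _ s ?_).trans (by simp)
      intro i _
      refine natDegree_sum_le_of_forall_le _ _ fun u _ => ?_
      exact (natDegree_C_mul_X_pow_le _ _).trans (by omega)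
    · refine natDegree_add_le_of_degree_le (by simp) ?_
      refine natDegree_sum_le_of_forall_le _ _ fun u _ => ?_
      exact (natDegree_C_mul_X_pow_le _ _).trans (by omega)
  have hev : ∀ y : F, (∏ i : Fin n, ∑ u : Fin (s + 1), y ^ (u.1 + 1) * R u i) *
      (1 + ∑ u : Fin (s + 1), y ^ (u.1 + 1) * l u) = y ^ n * Q.eval y := by
    intro y
    have : ∀ i, ∑ u : Fin (s + 1), y ^ (u.1 + 1) * R u i
        = y * ∑ u : Fin (s + 1), R u i * y ^ u.1 := by
      intro i
      rw [Finset.mul_sum]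
      exact Finset.sum_congr rfl fun u _ => by ring
    simp only [this, Finset.prod_mul_distrib, Q, eval_mul, eval_prod, eval_finsetSum, eval_add,
      eval_C, eval_pow, eval_X, eval_one]
    simp [mul_assoc, mul_comm (l _)]
  have hc : Q.coeff 0 = ∏ i : Fin n, R ⟨0, ht⟩ i := by
    rw [coeff_zero_eq_eval_zero]
    simp [Q, eval_prod, eval_finsetSum, Fin.sum_univ_succ]
  simp only [hev, eval_eq_sum_range' (Nat.lt_succ_of_le hdeg)]
  simp only [Finset.mul_sum]
  rw [Finset.sum_comm, Finset.sum_eq_single 0]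
  · rw [← hc]
    refine Eq.trans ?_ (mul_one (Q.coeff 0))
    rw [← h1, Finset.mul_sum]
    exact Finset.sum_congr rfl fun j _ => by ring
  · intro k hk hk0
    have hk' := Finset.mem_range.1 hk
    have := h0 (n + k) (by omega) (by rw [add_mul, mul_add]; omega)
    rw [← mul_zero (Q.coeff k), ← this, Finset.mul_sum]
    exact Finset.sum_congr rfl fun j _ => by ring
  · simp

/-- If `a ∈ 𝔽_p^N` (`N = d·t − d + 2`) satisfies `Σ_j a_j · j^(d−1) = 1` and
`Σ_j a_j · j^v = 0` for all `d ≤ v ≤ d·t`, then for any randomness `r_{u,i}`,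
`Σ_{j=1}^N a_j · (Π_{i=1}^{d−1} (Σ_{u=1}^t j^u r_{u,i})) · (1 + Σ_{u=1}^t j^u r_{u,d})
  = Π_{i=1}^{d−1} r_{1,i}`.
Here `r : Fin t → Fin d → ZMod p`, with `r u i` standing for `r_{u+1, i+1}`; the index
`⟨d-1, _⟩ : Fin d` is the last variable and `⟨0, ht⟩ : Fin t` corresponds to `u = 1`. -/
theorem stmt_3 (p d t : ℕ) [Fact p.Prime] (hd : 2 ≤ d) (ht : 1 ≤ t)
    (a : Fin (d * t - d + 2) → ZMod p)
    (ha1 : (∑ j, a j * ((j.1 + 1 : ℕ) : ZMod p) ^ (d - 1)) = 1)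
    (ha0 : ∀ v : ℕ, d ≤ v → v ≤ d * t →
      (∑ j, a j * ((j.1 + 1 : ℕ) : ZMod p) ^ v) = 0)
    (r : Fin t → Fin d → ZMod p) :
    ∑ j, a j *
      ((∏ i : Fin (d - 1),
          (∑ u : Fin t, ((j.1 + 1 : ℕ) : ZMod p) ^ (u.1 + 1) *
            r u (Fin.castLE (Nat.sub_le d 1) i))) *
        (1 + ∑ u : Fin t, ((j.1 + 1 : ℕ) : ZMod p) ^ (u.1 + 1) *
            r u ⟨d - 1, Nat.sub_lt (by omega) one_pos⟩))
      = ∏ i : Fin (d - 1), r ⟨0, ht⟩ (Fin.castLE (Nat.sub_le d 1) i) := by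
  have hd1 : d - 1 + 1 = d := by omega
  exact aux_share (d - 1) t ht a (fun j => ((j.1 + 1 : ℕ) : ZMod p)) ha1
    (by rw [hd1]; exact ha0) (fun u i => r u (Fin.castLE (Nat.sub_le d 1) i))
    (fun u => r u ⟨d - 1, Nat.sub_lt (by omega) one_pos⟩)
end

section
/- Let p be a prime, let d ≥ 2, t ≥ 1 and m ≥ d·t + 1 be integers with p > d·t. Consider the monomial f(x_1,…,x_d) = x_1⋯x_d and the two inputs x⁽⁰⁾ = (0,…,0) ∈ 𝔽_p^d and x⁽¹⁾ = (0,…,0,1) ∈ 𝔽_p^d, which satisfy f(x⁽⁰⁾) = f(x⁽¹⁾) = 0. For b ∈ {0,1}, let μ_b be the distribution of the m-tuple of output shares ( Π_{i=1}^{d} ( x_i⁽ᵇ⁾ + Σ_{u=1}^{t} j^u · r_{u,i} ) )_{j=1}^{m}, where the randomness (r_{u,i})_{u∈{1,…,t}, i∈{1,…,d}} is uniform over 𝔽_p^{t·d}. Then μ_0 ≠ μ_1; hence the m-server t-private Shamir-based HSS scheme is not context-hiding for x_1⋯x_d on domain 𝔽_p^d. -/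
/-- For a prime `p`, integers `d ≥ 2`, `t ≥ 1`, `m ≥ d·t + 1` with `p > d·t`,
the distributions `μ_0, μ_1` of the `m`-tuples of output shares
`(Π_{i=1}^d (x_i⁽ᵇ⁾ + Σ_{u=1}^t j^u · r_{u,i}))_{j=1}^m` of the Shamir-based HSS scheme for
the monomial `x_1⋯x_d` on the inputs `x⁽⁰⁾ = (0,…,0)` and `x⁽¹⁾ = (0,…,0,1)` (which have the
same function value `0`), over uniform randomness `(r_{u,i}) ∈ 𝔽_p^{t·d}`, are distinct;
hence the scheme is not context-hiding for `x_1⋯x_d` on `𝔽_p^d`. -/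
theorem stmt_5 (p d t m : ℕ) [Fact p.Prime] (hd : 2 ≤ d) (ht : 1 ≤ t)
    (hm : d * t + 1 ≤ m) (hpt : d * t < p) :
    PMF.map (fun r : Fin t → Fin d → ZMod p => fun j : Fin m =>
        ∏ i : Fin d,
          ((0 : ZMod p) + ∑ u : Fin t, ((j.1 + 1 : ℕ) : ZMod p) ^ (u.1 + 1) * r u i))
      (PMF.uniformOfFintype (Fin t → Fin d → ZMod p)) ≠
    PMF.map (fun r : Fin t → Fin d → ZMod p => fun j : Fin m =>
        ∏ i : Fin d,
          ((if i.1 = d - 1 then (1 : ZMod p) else 0) +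
            ∑ u : Fin t, ((j.1 + 1 : ℕ) : ZMod p) ^ (u.1 + 1) * r u i))
      (PMF.uniformOfFintype (Fin t → Fin d → ZMod p)) := by
  classical
  intro h
  obtain ⟨k, rfl⟩ : ∃ k, d = k + 1 := ⟨d - 1, by omega⟩
  obtain ⟨s, rfl⟩ : ∃ s, t = s + 1 := ⟨t - 1, by omega⟩
  let r1 : Fin (s + 1) → Fin (k + 1) → ZMod p :=
    fun u i => if i.1 = k then 0 else if u = 0 then 1 else 0
  have hmem : (fun j : Fin m => (((j.1 + 1 : ℕ) : ZMod p)) ^ k) ∈ (PMF.map (fun r : Fin (s+1) → Fin (k+1) → ZMod p => fun j : Fin m =>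
        ∏ i : Fin (k+1),
          ((if i.1 = k + 1 - 1 then (1 : ZMod p) else 0) +
            ∑ u : Fin (s+1), ((j.1 + 1 : ℕ) : ZMod p) ^ (u.1 + 1) * r u i))
      (PMF.uniformOfFintype (Fin (s+1) → Fin (k+1) → ZMod p))).support := by
    rw [PMF.mem_support_map_iff]
    refine ⟨r1, PMF.mem_support_uniformOfFintype _, ?_⟩
    funext j
    rw [Fin.prod_univ_castSucc]
    have h1 : ∀ i : Fin k, (i : ℕ) ≠ k := fun i => i.2.ne
    simp [r1, h1]
  rw [← h, PMF.mem_support_map_iff] at hmem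
  obtain ⟨r, -, hr⟩ := hmem
  let Q : Polynomial (ZMod p) := ∏ i : Fin (k+1), ∑ u : Fin (s+1),
    Polynomial.X ^ (u.1) * Polynomial.C (r u i)
  let P : Polynomial (ZMod p) := ∏ i : Fin (k+1), ∑ u : Fin (s+1),
    Polynomial.X ^ (u.1 + 1) * Polynomial.C (r u i)
  have hPQ : P = Polynomial.X ^ (k + 1) * Q := by
    have : (Polynomial.X : Polynomial (ZMod p)) ^ (k + 1)
        = ∏ i : Fin (k+1), Polynomial.X := by simp
    simp only [P, Q]
    rw [this, ← Finset.prod_mul_distrib]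
    refine Finset.prod_congr rfl fun i _ => ?_
    rw [Finset.mul_sum]
    exact Finset.sum_congr rfl fun u _ => by ring
  have hdeg : P.natDegree ≤ (k + 1) * (s + 1) := by
    refine (Polynomial.natDegree_prod_le _ _).trans ?_
    refine (Finset.sum_le_card_nsmul _ _ (s + 1) fun i _ => ?_).trans (by simp)
    refine Polynomial.natDegree_sum_le_of_forall_le _ _ fun u _ => ?_
    refine (Polynomial.natDegree_mul_C_le _ _).trans ?_
    rw [Polynomial.natDegree_X_pow]
    omega
  have hz : P - Polynomial.X ^ k = 0 := by
    refine Polynomial.eq_zero_of_natDegree_lt_card_of_eval_eq_zero _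
      (f := fun j : Fin ((k + 1) * (s + 1) + 1) => ((j.1 + 1 : ℕ) : ZMod p)) ?_ ?_ ?_
    · intro a b hab
      have hab' : ((a.1 : ℕ) : ZMod p) = ((b.1 : ℕ) : ZMod p) := by
        simpa using hab
      rw [ZMod.natCast_eq_natCast_iff] at hab'
      exact Fin.ext (Nat.ModEq.eq_of_lt_of_lt hab' (by omega) (by omega))
    · intro j
      have := congrFun hr ⟨j.1, by omega⟩
      simp only [zero_add] at this
      simp only [P, Polynomial.eval_sub, Polynomial.eval_prod, Polynomial.eval_finset_sum,
        Polynomial.eval_mul, Polynomial.eval_pow, Polynomial.eval_X, Polynomial.eval_C]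
      rw [this, sub_self]
    · rw [Fintype.card_fin, Nat.lt_succ_iff]
      refine (Polynomial.natDegree_sub_le _ _).trans (max_le hdeg ?_)
      rw [Polynomial.natDegree_X_pow]
      nlinarith
  have hc := congrArg (fun q => Polynomial.coeff q k) hz
  simp [hPQ, Polynomial.coeff_X_pow_mul'] at hc
end

section
/- Let p be a prime and let d ≥ 1, t ≥ 1, m ≥ 1 be integers. For any x⁽⁰⁾, x⁽¹⁾ ∈ 𝔽_p with (x⁽⁰⁾)^d = (x⁽¹⁾)^d, the two distributions (over uniform randomness (r_1, …, r_t) ∈ 𝔽_p^t) of the m-tuples ( ( x⁽ᵇ⁾ + Σ_{u=1}^{t} j^u · r_u )^d )_{j=1}^{m}, for b = 0 and b = 1, are equal. Hence the m-server t-private Shamir-based HSS scheme is perfectly context-hiding for f(x) = x^d on domain 𝔽_p. -/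
/-- For a prime `p` and integers `d, t, m ≥ 1`, for any `x⁽⁰⁾, x⁽¹⁾ ∈ 𝔽_p`
with `(x⁽⁰⁾)^d = (x⁽¹⁾)^d`, the distributions (over uniform randomness `(r_1,…,r_t) ∈ 𝔽_p^t`)
of the output-share tuples `((x⁽ᵇ⁾ + Σ_{u=1}^t j^u · r_u)^d)_{j=1}^m` for `b = 0, 1` are equal;
hence the Shamir-based HSS scheme is perfectly context-hiding for `x ↦ x^d` on `𝔽_p`. -/
theorem stmt_10 (p d t m : ℕ) [Fact p.Prime] (hd : 1 ≤ d) (ht : 1 ≤ t) (hm : 1 ≤ m)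
    (x0 x1 : ZMod p) (h : x0 ^ d = x1 ^ d) :
    PMF.map (fun r : Fin t → ZMod p => fun j : Fin m =>
        (x0 + ∑ u : Fin t, ((j.1 + 1 : ℕ) : ZMod p) ^ (u.1 + 1) * r u) ^ d)
      (PMF.uniformOfFintype (Fin t → ZMod p)) =
    PMF.map (fun r : Fin t → ZMod p => fun j : Fin m =>
        (x1 + ∑ u : Fin t, ((j.1 + 1 : ℕ) : ZMod p) ^ (u.1 + 1) * r u) ^ d)
      (PMF.uniformOfFintype (Fin t → ZMod p)) := by
  obtain ⟨c, hc0, hcd, hx⟩ : ∃ c : ZMod p, c ≠ 0 ∧ c ^ d = 1 ∧ x1 = c * x0 := by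
    by_cases h0 : x0 = 0
    · subst h0
      rw [zero_pow (by omega)] at h
      have h1 : x1 = 0 := eq_zero_of_pow_eq_zero h.symm
      exact ⟨1, one_ne_zero, one_pow d, by simp [h1]⟩
    · have hp : x0 ^ d ≠ 0 := pow_ne_zero d h0
      have h1 : x1 ≠ 0 := by
        rintro rfl
        rw [zero_pow (by omega)] at h
        exact hp h
      refine ⟨x1 / x0, div_ne_zero h1 h0, ?_, ?_⟩
      · rw [div_pow, ← h, div_self hp]
      · rw [div_mul_cancel₀ _ h0]
  have hU : PMF.map (fun r : Fin t → ZMod p => c • r)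
      (PMF.uniformOfFintype (Fin t → ZMod p)) = PMF.uniformOfFintype (Fin t → ZMod p) := by
    ext s
    rw [PMF.map_apply, tsum_eq_single (c⁻¹ • s)]
    · simp [smul_smul, hc0]
    · intro r hr
      rw [if_neg]
      rintro rfl
      exact hr (by simp [smul_smul, hc0])
  conv_rhs => rw [← hU, PMF.map_comp]
  congr 1
  funext r j
  simp only [Function.comp, Pi.smul_apply, smul_eq_mul]
  have e : x1 + ∑ u : Fin t, ((j.1 + 1 : ℕ) : ZMod p) ^ (u.1 + 1) * (c * r u)
      = c * (x0 + ∑ u : Fin t, ((j.1 + 1 : ℕ) : ZMod p) ^ (u.1 + 1) * r u) := by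
    rw [hx, mul_add, Finset.mul_sum]
    congr 1
    exact Finset.sum_congr rfl fun u _ => by ring
  rw [e, mul_pow, hcd, one_mul]
end

section
/- Let p be a prime, let n ≥ 1, t ≥ 1, m ≥ 1 be integers and d_1, …, d_n ≥ 1 integers. Let x⁽⁰⁾, x⁽¹⁾ ∈ 𝔽_p^n and c_1, …, c_n ∈ 𝔽_p satisfy x⁽¹⁾_i = c_i · x⁽⁰⁾_i for all i and Π_{i=1}^{n} c_i^{d_i} = 1. Then for every j ∈ {1, …, m} and every family (r_{u,i}) ∈ 𝔽_p^{t·n}, Π_{i=1}^{n} ( x⁽¹⁾_i + Σ_{u=1}^{t} j^u · (c_i · r_{u,i}) )^{d_i} = Π_{i=1}^{n} ( x⁽⁰⁾_i + Σ_{u=1}^{t} j^u · r_{u,i} )^{d_i}. -/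
/-- For a prime `p`, integers `n, t, m ≥ 1` and exponents `d_i ≥ 1`, if
`x⁽¹⁾_i = c_i · x⁽⁰⁾_i` for all `i` and `Π_i c_i^{d_i} = 1`, then for every `j ∈ {1,…,m}`
and randomness `(r_{u,i})`,
`Π_i (x⁽¹⁾_i + Σ_u j^u·(c_i·r_{u,i}))^{d_i} = Π_i (x⁽⁰⁾_i + Σ_u j^u·r_{u,i})^{d_i}`. -/
theorem stmt_12 (p n t m : ℕ) [Fact p.Prime] (hn : 1 ≤ n) (ht : 1 ≤ t) (hm : 1 ≤ m)
    (d : Fin n → ℕ) (hd : ∀ i, 1 ≤ d i)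
    (x0 x1 c : Fin n → ZMod p)
    (hx : ∀ i, x1 i = c i * x0 i) (hc : ∏ i, (c i) ^ (d i) = 1)
    (j : ℕ) (hj1 : 1 ≤ j) (hjm : j ≤ m) (r : Fin t → Fin n → ZMod p) :
    ∏ i, (x1 i + ∑ u : Fin t, (j : ZMod p) ^ (u.1 + 1) * (c i * r u i)) ^ (d i)
      = ∏ i, (x0 i + ∑ u : Fin t, (j : ZMod p) ^ (u.1 + 1) * r u i) ^ (d i) := by
  rw [← one_mul (∏ i, (x0 i + _) ^ (d i)), ← hc, ← Finset.prod_mul_distrib]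
  refine Finset.prod_congr rfl fun i _ => ?_
  rw [← mul_pow, hx i, mul_add, Finset.mul_sum]
  congr 2
  refine Finset.sum_congr rfl fun u _ => ?_
  ring
end

section
/- Let p be a prime and let n ≥ 1, t ≥ 1, m ≥ 1 be integers and d_1, …, d_n ≥ 1 integers. For any two vectors x⁽⁰⁾, x⁽¹⁾ with all entries in 𝔽_p^* = 𝔽_p \ {0} satisfying Π_{i=1}^{n} (x⁽⁰⁾_i)^{d_i} = Π_{i=1}^{n} (x⁽¹⁾_i)^{d_i}, the two distributions (over uniform randomness (r_{u,i})_{u∈{1,…,t}, i∈{1,…,n}} ∈ 𝔽_p^{t·n}) of the m-tuples ( Π_{i=1}^{n} ( x⁽ᵇ⁾_i + Σ_{u=1}^{t} j^u · r_{u,i} )^{d_i} )_{j=1}^{m}, for b = 0 and b = 1, are equal. Hence the m-server t-private Shamir-based HSS scheme is perfectly context-hiding for f(x) = Π_{i=1}^{n} x_i^{d_i} on domain (𝔽_p^*)^n. -/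
/-- For a prime `p`, integers `n, t, m ≥ 1` and exponents `d_i ≥ 1`, for any
vectors `x⁽⁰⁾, x⁽¹⁾` with all entries in `𝔽_p^*` and `Π_i (x⁽⁰⁾_i)^{d_i} = Π_i (x⁽¹⁾_i)^{d_i}`,
the distributions (over uniform randomness `(r_{u,i}) ∈ 𝔽_p^{t·n}`) of the output-share tuples
`(Π_i (x⁽ᵇ⁾_i + Σ_u j^u·r_{u,i})^{d_i})_{j=1}^m` for `b = 0, 1` are equal; hence the
Shamir-based HSS scheme is perfectly context-hiding for `Π_i x_i^{d_i}` on `(𝔽_p^*)^n`. -/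
theorem stmt_13 (p n t m : ℕ) [Fact p.Prime] (hn : 1 ≤ n) (ht : 1 ≤ t) (hm : 1 ≤ m)
    (d : Fin n → ℕ) (hd : ∀ i, 1 ≤ d i)
    (x0 x1 : Fin n → ZMod p) (h0 : ∀ i, x0 i ≠ 0) (h1 : ∀ i, x1 i ≠ 0)
    (heq : ∏ i, (x0 i) ^ (d i) = ∏ i, (x1 i) ^ (d i)) :
    PMF.map (fun r : Fin t → Fin n → ZMod p => fun j : Fin m =>
        ∏ i, (x0 i + ∑ u : Fin t, ((j.1 + 1 : ℕ) : ZMod p) ^ (u.1 + 1) * r u i) ^ (d i))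
      (PMF.uniformOfFintype (Fin t → Fin n → ZMod p)) =
    PMF.map (fun r : Fin t → Fin n → ZMod p => fun j : Fin m =>
        ∏ i, (x1 i + ∑ u : Fin t, ((j.1 + 1 : ℕ) : ZMod p) ^ (u.1 + 1) * r u i) ^ (d i))
      (PMF.uniformOfFintype (Fin t → Fin n → ZMod p)) := by
  classical
  let e : (Fin t → Fin n → ZMod p) ≃ (Fin t → Fin n → ZMod p) :=
    Equiv.piCongrRight fun _ => Equiv.piCongrRight fun i =>
      Equiv.mulLeft₀ (x1 i / x0 i) (div_ne_zero (h1 i) (h0 i))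
  have he : ∀ r u i, e r u i = x1 i / x0 i * r u i := fun _ _ _ => rfl
  have hc : ∏ i, (x1 i / x0 i) ^ (d i) = 1 := by
    simp only [div_pow, Finset.prod_div_distrib]
    rw [heq]
    exact div_self (Finset.prod_ne_zero_iff.mpr fun i _ => pow_ne_zero _ (h1 i))
  have key : ∀ r : Fin t → Fin n → ZMod p, ∀ j : Fin m,
      ∏ i, (x1 i + ∑ u : Fin t, ((j.1 + 1 : ℕ) : ZMod p) ^ (u.1 + 1) * e r u i) ^ (d i) =
      ∏ i, (x0 i + ∑ u : Fin t, ((j.1 + 1 : ℕ) : ZMod p) ^ (u.1 + 1) * r u i) ^ (d i) := by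
    intro r j
    rw [← one_mul (∏ i, (x0 i + _) ^ (d i)), ← hc, ← Finset.prod_mul_distrib]
    refine Finset.prod_congr rfl fun i _ => ?_
    rw [← mul_pow, mul_add, div_mul_cancel₀ _ (h0 i), Finset.mul_sum]
    congr 2
    refine Finset.sum_congr rfl fun u _ => ?_
    rw [he]
    ring
  ext y
  simp only [PMF.map_apply, PMF.uniformOfFintype_apply]
  symm
  rw [← e.tsum_eq]
  simp only [key]
end

section
/- Let p be a prime, n ≥ 1, t ≥ 1, m ≥ 1, and suppose f, g : 𝔽_p^n → 𝔽_p satisfy g(x) = α·( f((x + c)·L + e) + β ) + γ for all x ∈ 𝔽_p^n, where α ∈ 𝔽_p^*, β, γ ∈ 𝔽_p, L is an invertible n×n matrix over 𝔽_p, and c, e ∈ 𝔽_p^n. If f is perfectly context-hiding for the m-server t-private Shamir-based HSS scheme — i.e., for all u⁽⁰⁾, u⁽¹⁾ ∈ 𝔽_p^n with f(u⁽⁰⁾) = f(u⁽¹⁾), the distributions over uniform randomness (r_1,…,r_t) ∈ (𝔽_p^n)^t of ( f( u⁽ᵇ⁾ + Σ_{u=1}^{t} j^u · r_u ) )_{j=1}^{m}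 for b = 0 and b = 1 are equal — then g is perfectly context-hiding as well: for all x⁽⁰⁾, x⁽¹⁾ ∈ 𝔽_p^n with g(x⁽⁰⁾) = g(x⁽¹⁾), the distributions over uniform randomness of ( g( x⁽ᵇ⁾ + Σ_{u=1}^{t} j^u · r_u ) )_{j=1}^{m} for b = 0 and b = 1 are equal. -/
theorem map_uniform_of_bij {A : Type*} [Fintype A] [Nonempty A] (E : A → A)
    (hE : Function.Bijective E) :
    PMF.map E (PMF.uniformOfFintype A) = PMF.uniformOfFintype A := by
  ext b
  obtain ⟨a, rfl⟩ := hE.2 b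
  rw [PMF.map_apply, tsum_eq_single a]
  · simp
  · intro a' h
    rw [if_neg]
    intro h2
    exact h (hE.1 h2.symm)

/-- Suppose `g(x) = α·(f((x + c)·L + e) + β) + γ` for all `x ∈ 𝔽_p^n`, with
`α ∈ 𝔽_p^*`, `L ∈ GL_n(𝔽_p)`, `c, e ∈ 𝔽_p^n`. If `f` is perfectly context-hiding for the
`m`-server `t`-private Shamir-based HSS scheme (for any two inputs with equal `f`-values,
the distributions of the output-share tuples `(f(u⁽ᵇ⁾ + Σ_u j^u·r_u))_{j=1}^m` over uniform
randomness `(r_1,…,r_t) ∈ (𝔽_p^n)^t` coincide), then so is `g`. -/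
theorem stmt_17 (p n t m : ℕ) [Fact p.Prime] (hn : 1 ≤ n) (ht : 1 ≤ t) (hm : 1 ≤ m)
    (α β γ : ZMod p) (hα : α ≠ 0)
    (L : Matrix (Fin n) (Fin n) (ZMod p)) (hL : IsUnit L)
    (c e : Fin n → ZMod p) (f g : (Fin n → ZMod p) → ZMod p)
    (hg : ∀ x : Fin n → ZMod p, g x = α * (f (Matrix.vecMul (x + c) L + e) + β) + γ)
    (hf : ∀ u0 u1 : Fin n → ZMod p, f u0 = f u1 →
      PMF.map (fun r : Fin t → Fin n → ZMod p => fun j : Fin m =>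
          f (u0 + ∑ u : Fin t, (((j.1 + 1 : ℕ) : ZMod p) ^ (u.1 + 1)) • r u))
        (PMF.uniformOfFintype (Fin t → Fin n → ZMod p)) =
      PMF.map (fun r : Fin t → Fin n → ZMod p => fun j : Fin m =>
          f (u1 + ∑ u : Fin t, (((j.1 + 1 : ℕ) : ZMod p) ^ (u.1 + 1)) • r u))
        (PMF.uniformOfFintype (Fin t → Fin n → ZMod p))) :
    ∀ x0 x1 : Fin n → ZMod p, g x0 = g x1 →
      PMF.map (fun r : Fin t → Fin n → ZMod p => fun j : Fin m =>
          g (x0 + ∑ u : Fin t, (((j.1 + 1 : ℕ) : ZMod p) ^ (u.1 + 1)) • r u))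
        (PMF.uniformOfFintype (Fin t → Fin n → ZMod p)) =
      PMF.map (fun r : Fin t → Fin n → ZMod p => fun j : Fin m =>
          g (x1 + ∑ u : Fin t, (((j.1 + 1 : ℕ) : ZMod p) ^ (u.1 + 1)) • r u))
        (PMF.uniformOfFintype (Fin t → Fin n → ZMod p)) := by
  have hE : Function.Bijective
      (fun (r : Fin t → Fin n → ZMod p) (u : Fin t) => Matrix.vecMul (r u) L) := by
    rw [← Finite.injective_iff_bijective]
    intro r s h
    funext u
    exact Matrix.vecMul_injective_of_isUnit hL (congrFun h u)
  have key : ∀ x : Fin n → ZMod p,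
      PMF.map (fun r : Fin t → Fin n → ZMod p => fun j : Fin m =>
          g (x + ∑ u : Fin t, (((j.1 + 1 : ℕ) : ZMod p) ^ (u.1 + 1)) • r u))
        (PMF.uniformOfFintype (Fin t → Fin n → ZMod p)) =
      PMF.map (fun (y : Fin m → ZMod p) (j : Fin m) => α * (y j + β) + γ)
        (PMF.map (fun r : Fin t → Fin n → ZMod p => fun j : Fin m =>
          f ((Matrix.vecMul (x + c) L + e) +
            ∑ u : Fin t, (((j.1 + 1 : ℕ) : ZMod p) ^ (u.1 + 1)) • r u))
        (PMF.uniformOfFintype (Fin t → Fin n → ZMod p))) := by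
    intro x
    conv_rhs => rw [← map_uniform_of_bij _ hE]
    rw [PMF.map_comp, PMF.map_comp]
    congr 1
    funext r j
    simp only [Function.comp, hg]
    congr 4
    simp only [Matrix.add_vecMul, Matrix.sum_vecMul, Matrix.smul_vecMul]
    abel
  intro x0 x1 h
  rw [key x0, key x1, hf]
  rw [hg, hg] at h
  exact add_right_cancel (mul_left_cancel₀ hα (add_right_cancel h))
end
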